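/- arXiv:2602.14680 — 5 statements merged into one kernel-verified Lean document; each statement's English description precedes it below -/
import Mathlib

section
/- Let K, K', M be simplicial complexes, let φ, ψ : K → K' and α : M → K be simplicial maps, and fix an integer m ≥ 1. Then SD_m(φ ∘ α, ψ ∘ α) ≤ SD_m(φ, ψ). -/
noncomputable section
open scoped Classical

/-- An abstract simplicial complex on vertex type `V`: a collection of nonempty
finite subsets (simplices) closed under passing to nonempty subsets. -/
structure SComplex (V : Type) where
  faces : Set (Finset V)
  nonempty_of_mem : ∀ σ ∈ faces, σ.Nonempty
  down_closed : ∀ σ ∈ faces, ∀ τ ⊆ σ, τ.Nonempty → τ ∈ faces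

namespace SComplex

/-- `f` is a simplicial map from `K` to `L`. -/
def IsSimplicialMap {V W : Type} (K : SComplex V) (L : SComplex W) (f : V → W) : Prop :=
  ∀ σ ∈ K.faces, σ.image f ∈ L.faces

/-- `f` and `g` are contiguous as maps from `K` to `L`. -/
def Contiguous {V W : Type} (K : SComplex V) (L : SComplex W) (f g : V → W) : Prop :=
  ∀ σ ∈ K.faces, σ.image f ∪ σ.image g ∈ L.faces

/-- `f` and `g` are in the same contiguity class: there is a finite chain of
simplicial maps from `f` to `g` in which consecutive maps are contiguous. -/
def SameClass {V W : Type} (K : SComplex V) (L : SComplex W) (f g : V → W) : Prop :=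
  Relation.ReflTransGen
    (fun a b => K.IsSimplicialMap L a ∧ K.IsSimplicialMap L b ∧ K.Contiguous L a b) f g

/-- `K'` is a subcomplex of `K`. -/
def IsSubcomplex {V : Type} (K' K : SComplex V) : Prop :=
  K'.faces ⊆ K.faces

/-- `Ks` is a covering of `K` by subcomplexes. -/
def Covers {V : Type} (K : SComplex V) {k : ℕ} (Ks : Fin (k + 1) → SComplex V) : Prop :=
  (∀ j, (Ks j).IsSubcomplex K) ∧ ∀ σ ∈ K.faces, ∃ j, σ ∈ (Ks j).faces

/-- `P` has dimension at most `m`. -/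
def DimLE {U : Type} (P : SComplex U) (m : ℕ) : Prop :=
  ∀ σ ∈ P.faces, σ.card ≤ m + 1

/-- The `m`-contiguity distance `SD_m(φ, ψ)`. -/
noncomputable def SDm {V W : Type} (m : ℕ) (K : SComplex V) (L : SComplex W)
    (φ ψ : V → W) : ℕ∞ :=
  sInf {n : ℕ∞ | ∃ k : ℕ, n = (k : ℕ∞) ∧ ∃ Ks : Fin (k + 1) → SComplex V, K.Covers Ks ∧
    ∀ j, ∀ (P : Type) (PC : SComplex P), PC.DimLE m →
      ∀ η : P → V, PC.IsSimplicialMap (Ks j) η → PC.SameClass L (φ ∘ η) (ψ ∘ η)}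

/-- The contiguity distance `SD(φ, ψ)`. -/
noncomputable def SD {V W : Type} (K : SComplex V) (L : SComplex W) (φ ψ : V → W) : ℕ∞ :=
  sInf {n : ℕ∞ | ∃ k : ℕ, n = (k : ℕ∞) ∧ ∃ Ks : Fin (k + 1) → SComplex V, K.Covers Ks ∧
    ∀ j, (Ks j).SameClass L φ ψ}

/-- The `m`-simplicial Lusternik–Schnirelmann category `scat_m(K)`. -/
noncomputable def scatm {V : Type} (m : ℕ) (K : SComplex V) : ℕ∞ :=
  sInf {n : ℕ∞ | ∃ k : ℕ, n = (k : ℕ∞) ∧ ∃ Ks : Fin (k + 1) → SComplex V, K.Covers Ks ∧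
    ∀ j, ∀ (P : Type) (PC : SComplex P), PC.DimLE m →
      ∀ η : P → V, PC.IsSimplicialMap (Ks j) η →
        ∃ v0 : V, PC.SameClass K η (fun _ => v0)}

/-- The simplicial Lusternik–Schnirelmann category `scat(K)`. -/
noncomputable def scat {V : Type} (K : SComplex V) : ℕ∞ :=
  sInf {n : ℕ∞ | ∃ k : ℕ, n = (k : ℕ∞) ∧ ∃ Ks : Fin (k + 1) → SComplex V, K.Covers Ks ∧
    ∀ j, ∃ v0 : V, (Ks j).SameClass K id (fun _ => v0)}

/-- The categorical product of two simplicial complexes. -/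
def prod {V W : Type} (K : SComplex V) (L : SComplex W) : SComplex (V × W) where
  faces := {σ | σ.Nonempty ∧ σ.image Prod.fst ∈ K.faces ∧ σ.image Prod.snd ∈ L.faces}
  nonempty_of_mem := fun _ h => h.1
  down_closed := by
    rintro σ ⟨-, h1, h2⟩ τ hτσ hτ
    exact ⟨hτ, K.down_closed _ h1 _ (Finset.image_subset_image hτσ) (hτ.image _),
      L.down_closed _ h2 _ (Finset.image_subset_image hτσ) (hτ.image _)⟩

/-- The barycentric subdivision: vertices are the simplices of `K`, simplices are
the chains of simplices of `K` (totally ordered by inclusion). -/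
def sd {V : Type} (K : SComplex V) : SComplex (Finset V) where
  faces := {S | S.Nonempty ∧ (∀ σ ∈ S, σ ∈ K.faces) ∧ ∀ σ ∈ S, ∀ τ ∈ S, σ ⊆ τ ∨ τ ⊆ σ}
  nonempty_of_mem := fun _ h => h.1
  down_closed := by
    rintro S ⟨-, h1, h2⟩ T hTS hT
    exact ⟨hT, fun σ hσ => h1 σ (hTS hσ), fun σ hσ τ hτ => h2 σ (hTS hσ) τ (hTS hτ)⟩

/-- The map induced on barycentric subdivisions: `sd(f)(σ) = f(σ)`. -/
def sdMap {V W : Type} (f : V → W) : Finset V → Finset W :=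
  fun σ => σ.image f

/-- The `m`-dimensional simplicial Švarc genus `secat_m(φ)`. -/
noncomputable def secatm {V W : Type} (m : ℕ) (K : SComplex V) (L : SComplex W)
    (φ : V → W) : ℕ∞ :=
  sInf {n : ℕ∞ | ∃ k : ℕ, n = (k : ℕ∞) ∧ ∃ Ls : Fin (k + 1) → SComplex W, L.Covers Ls ∧
    ∀ j, ∀ (P : Type) (PC : SComplex P), PC.DimLE m →
      ∀ η : P → W, PC.IsSimplicialMap (Ls j) η →
        ∃ s : P → V, PC.IsSimplicialMap K s ∧ φ ∘ s = η}

/-- The `m`-dimensional homotopy simplicial Švarc genus `hsecat_m(φ)`. -/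
noncomputable def hsecatm {V W : Type} (m : ℕ) (K : SComplex V) (L : SComplex W)
    (φ : V → W) : ℕ∞ :=
  sInf {n : ℕ∞ | ∃ k : ℕ, n = (k : ℕ∞) ∧ ∃ Ls : Fin (k + 1) → SComplex W, L.Covers Ls ∧
    ∀ j, ∀ (P : Type) (PC : SComplex P), PC.DimLE m →
      ∀ η : P → W, PC.IsSimplicialMap (Ls j) η →
        ∃ s : P → V, PC.IsSimplicialMap K s ∧ PC.SameClass L (φ ∘ s) η}

/-- The `m`-simplicial LS category `scat_m(φ)` of a simplicial map `φ : K → L`. -/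
noncomputable def scatmMap {V W : Type} (m : ℕ) (K : SComplex V) (L : SComplex W)
    (φ : V → W) : ℕ∞ :=
  sInf {n : ℕ∞ | ∃ k : ℕ, n = (k : ℕ∞) ∧ ∃ Ks : Fin (k + 1) → SComplex V, K.Covers Ks ∧
    ∀ j, ∀ (P : Type) (PC : SComplex P), PC.DimLE m →
      ∀ η : P → V, PC.IsSimplicialMap (Ks j) η →
        ∃ w0 : W, PC.SameClass L (φ ∘ η) (fun _ => w0)}

/-- `p : E → B` is a simplicial fibration. -/
def IsFibration {Ve Vb : Type} (E : SComplex Ve) (B : SComplex Vb) (p : Ve → Vb) : Prop :=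
  ∀ (X : Type) (KC : SComplex X) (ℓ : ℕ) (φs : Fin (ℓ + 1) → X → Vb),
    (∀ i, KC.IsSimplicialMap B (φs i)) →
    (∀ i : Fin ℓ, KC.Contiguous B (φs i.castSucc) (φs i.succ)) →
    ∀ φt : X → Ve, KC.IsSimplicialMap E φt → p ∘ φt = φs 0 →
      ∃ φts : Fin (ℓ + 1) → X → Ve, φts 0 = φt ∧
        (∀ i, KC.IsSimplicialMap E (φts i)) ∧
        (∀ i : Fin ℓ, KC.Contiguous E (φts i.castSucc) (φts i.succ)) ∧
        ∀ i, p ∘ φts i = φs i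

/-- `β : K → M` is a strong equivalence. -/
def IsStrongEquivalence {V U : Type} (K : SComplex V) (M : SComplex U) (β : V → U) : Prop :=
  K.IsSimplicialMap M β ∧ ∃ δ : U → V, M.IsSimplicialMap K δ ∧
    K.SameClass K (δ ∘ β) id ∧ M.SameClass M (β ∘ δ) id

/-- The diagonal map `Δ : V → V × V`. -/
def diag (V : Type) : V → V × V := fun v => (v, v)

/-- The `m`-discrete topological complexity `TC^m(K)`. -/
noncomputable def TCm {V : Type} (m : ℕ) (K : SComplex V) : ℕ∞ :=
  sInf {n : ℕ∞ | ∃ k : ℕ, n = (k : ℕ∞) ∧ ∃ Ωs : Fin (k + 1) → SComplex (V × V),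
    (K.prod K).Covers Ωs ∧
    ∀ j, ∃ σj : V × V → V, (Ωs j).IsSimplicialMap K σj ∧
      ∀ (P : Type) (PC : SComplex P), PC.DimLE m →
        ∀ η : P → V × V, PC.IsSimplicialMap (Ωs j) η →
          PC.SameClass (K.prod K) (diag V ∘ σj ∘ η) η}

/-- The discrete topological complexity `TC(K)`. -/
noncomputable def TC {V : Type} (K : SComplex V) : ℕ∞ :=
  sInf {n : ℕ∞ | ∃ k : ℕ, n = (k : ℕ∞) ∧ ∃ Ωs : Fin (k + 1) → SComplex (V × V),
    (K.prod K).Covers Ωs ∧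
    ∀ j, ∃ σj : V × V → V, (Ωs j).IsSimplicialMap K σj ∧
      (Ωs j).SameClass (K.prod K) (diag V ∘ σj) id}

end SComplex

open SComplex

namespace SComplex

/-- The subcomplex of `M` whose simplices are sent by `α` to simplices of `L`. -/
def preimage {U V : Type} (M : SComplex U) (L : SComplex V) (α : U → V) : SComplex U where
  faces := {σ | σ ∈ M.faces ∧ σ.image α ∈ L.faces}
  nonempty_of_mem := fun σ h => M.nonempty_of_mem σ h.1
  down_closed := fun σ h τ hτσ hτ =>
    ⟨M.down_closed σ h.1 τ hτσ hτ,
      L.down_closed _ h.2 _ (Finset.image_subset_image hτσ) (hτ.image α)⟩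

theorem IsSimplicialMap.comp {P U V : Type} {A : SComplex P} {B : SComplex U} {C : SComplex V}
    {g : U → V} {f : P → U} (hg : B.IsSimplicialMap C g) (hf : A.IsSimplicialMap B f) :
    A.IsSimplicialMap C (g ∘ f) := fun σ hσ => by
  simpa only [Finset.image_image] using hg _ (hf σ hσ)

theorem isSimplicialMap_preimage {U V : Type} (M : SComplex U) (L : SComplex V) (α : U → V) :
    (M.preimage L α).IsSimplicialMap L α := fun _ h => h.2

theorem Covers.preimage {U V : Type} {M : SComplex U} {K : SComplex V} {α : U → V}
    (hα : M.IsSimplicialMap K α) {k : ℕ} {Ks : Fin (k + 1) → SComplex V} (h : K.Covers Ks) :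
    M.Covers fun j => M.preimage (Ks j) α :=
  ⟨fun _ _ hσ => hσ.1, fun σ hσ => (h.2 _ (hα σ hσ)).imp fun _ hj => ⟨hσ, hj⟩⟩

end SComplex

/-- `SD_m(φ ∘ α, ψ ∘ α) ≤ SD_m(φ, ψ)`. -/
theorem SDm_comp_right_le {V W U : Type} (K : SComplex V) (K' : SComplex W) (M : SComplex U)
    (φ ψ : V → W) (α : U → V)
    (hφ : K.IsSimplicialMap K' φ) (hψ : K.IsSimplicialMap K' ψ)
    (hα : M.IsSimplicialMap K α) (m : ℕ) (hm : 1 ≤ m) :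
    SDm m M K' (φ ∘ α) (ψ ∘ α) ≤ SDm m K K' φ ψ := by
  refine sInf_le_sInf ?_
  rintro n ⟨k, rfl, Ks, hKs, hclass⟩
  exact ⟨k, rfl, _, hKs.preimage hα, fun j P PC hP η hη =>
    hclass j P PC hP (α ∘ η) ((isSimplicialMap_preimage M (Ks j) α).comp hη)⟩
end
end

section
/- Let K, K', M be simplicial complexes, let φ, ψ : K → K' and β : K' → M be simplicial maps, and fix an integer m ≥ 1. Then SD_m(β ∘ φ, β ∘ ψ) ≤ SD_m(φ, ψ). -/
noncomputable section
open scoped Classical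

open SComplex

namespace SComplex

theorem IsSimplicialMap.comp_s1 {X V W : Type} {P : SComplex X} {K : SComplex V} {L : SComplex W}
    {g : V → W} {f : X → V} (hg : K.IsSimplicialMap L g) (hf : P.IsSimplicialMap K f) :
    P.IsSimplicialMap L (g ∘ f) := fun σ hσ => by
  simpa only [Finset.image_image] using hg _ (hf σ hσ)

theorem Contiguous.comp_left {X V W : Type} {P : SComplex X} {K : SComplex V} {L : SComplex W}
    {g : V → W} {f₁ f₂ : X → V} (hg : K.IsSimplicialMap L g) (hf : P.Contiguous K f₁ f₂) :
    P.Contiguous L (g ∘ f₁) (g ∘ f₂) := fun σ hσ => by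
  simpa only [Finset.image_union, Finset.image_image] using hg _ (hf σ hσ)

theorem SameClass.comp_left {X V W : Type} {P : SComplex X} {K : SComplex V} {L : SComplex W}
    {g : V → W} {f₁ f₂ : X → V} (hg : K.IsSimplicialMap L g) (hf : P.SameClass K f₁ f₂) :
    P.SameClass L (g ∘ f₁) (g ∘ f₂) :=
  Relation.ReflTransGen.lift (g ∘ ·) (fun _ _ ⟨ha, hb, hab⟩ =>
    ⟨hg.comp_s1 ha, hg.comp_s1 hb, hab.comp_left hg⟩) _ _ hf

end SComplex

/-- `SD_m(β ∘ φ, β ∘ ψ) ≤ SD_m(φ, ψ)`. -/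
theorem SDm_comp_left_le {V W U : Type} (K : SComplex V) (K' : SComplex W) (M : SComplex U)
    (φ ψ : V → W) (β : W → U)
    (hφ : K.IsSimplicialMap K' φ) (hψ : K.IsSimplicialMap K' ψ)
    (hβ : K'.IsSimplicialMap M β) (m : ℕ) (hm : 1 ≤ m) :
    SDm m K M (β ∘ φ) (β ∘ ψ) ≤ SDm m K K' φ ψ := by
  refine sInf_le_sInf ?_
  rintro n ⟨k, rfl, Ks, hKs, h⟩
  exact ⟨k, rfl, Ks, hKs, fun j P PC hP η hη => (h j P PC hP η hη).comp_left hβ⟩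
end
end

section
/- Let φ, ψ : K → L and φ', ψ' : K' → L' be simplicial maps with φ in the same contiguity class as ψ and φ' in the same contiguity class as ψ'. Then the product maps φ × φ' and ψ × ψ' : K × K' → L × L' (between categorical products) are in the same contiguity class. -/
noncomputable section
open scoped Classical

open SComplex

theorem SComplex.IsSimplicialMap.contiguous_self {V W : Type} {K : SComplex V} {L : SComplex W}
    {f : V → W} (hf : K.IsSimplicialMap L f) : K.Contiguous L f f := fun σ hσ => by
  rw [Finset.union_self]
  exact hf σ hσ

theorem SComplex.IsSimplicialMap.prodMap {V W V' W' : Type} {K : SComplex V} {L : SComplex W}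
    {K' : SComplex V'} {L' : SComplex W'} {f : V → W} {f' : V' → W'}
    (hf : K.IsSimplicialMap L f) (hf' : K'.IsSimplicialMap L' f') :
    (K.prod K').IsSimplicialMap (L.prod L') (Prod.map f f') := by
  rintro σ ⟨hσ, h1, h2⟩
  refine ⟨by simpa using hσ, ?_, ?_⟩
  · simpa only [Finset.image_image, Prod.map_fst'] using hf _ h1
  · simpa only [Finset.image_image, Prod.map_snd'] using hf' _ h2

theorem SComplex.Contiguous.prodMap {V W V' W' : Type} {K : SComplex V} {L : SComplex W}
    {K' : SComplex V'} {L' : SComplex W'} {f g : V → W} {f' g' : V' → W'}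
    (h : K.Contiguous L f g) (h' : K'.Contiguous L' f' g') :
    (K.prod K').Contiguous (L.prod L') (Prod.map f f') (Prod.map g g') := by
  rintro σ ⟨hσ, h1, h2⟩
  refine ⟨by simp [hσ], ?_, ?_⟩
  · simpa only [Finset.image_union, Finset.image_image, Prod.map_fst'] using h _ h1
  · simpa only [Finset.image_union, Finset.image_image, Prod.map_snd'] using h' _ h2

/-- if `φ ~ ψ` and `φ' ~ ψ'` then `φ × φ' ~ ψ × ψ'`. -/
theorem prodMap_sameClass {V W V' W' : Type} (K : SComplex V) (L : SComplex W)
    (K' : SComplex V') (L' : SComplex W')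
    (φ ψ : V → W) (φ' ψ' : V' → W')
    (hφ : K.IsSimplicialMap L φ) (hψ : K.IsSimplicialMap L ψ)
    (hφ' : K'.IsSimplicialMap L' φ') (hψ' : K'.IsSimplicialMap L' ψ')
    (h : K.SameClass L φ ψ) (h' : K'.SameClass L' φ' ψ') :
    (K.prod K').SameClass (L.prod L') (Prod.map φ φ') (Prod.map ψ ψ') := by
  refine Relation.ReflTransGen.trans (b := Prod.map ψ φ') ?_ ?_
  · exact h.lift (Prod.map · φ') fun _ _ ⟨ha, hb, hab⟩ =>
      ⟨ha.prodMap hφ', hb.prodMap hφ', hab.prodMap hφ'.contiguous_self⟩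
  · exact h'.lift (Prod.map ψ ·) fun _ _ ⟨ha, hb, hab⟩ =>
      ⟨hψ.prodMap ha, hψ.prodMap hb, hψ.contiguous_self.prodMap hab⟩
end
end

section
/- Let p : E → B be a simplicial fibration and fix an integer m ≥ 1. Then hsecat_m(p) = secat_m(p). -/
noncomputable section
open scoped Classical

open SComplex

/-- Lifts of simplicial maps through a simplicial fibration are transported along contiguity
classes. -/
theorem SComplex.IsFibration.exists_lift_of_sameClass {Ve Vb X : Type} {E : SComplex Ve}
    {B : SComplex Vb} {p : Ve → Vb} (hfib : IsFibration E B p) {K : SComplex X} {f g : X → Vb}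
    (hfg : K.SameClass B f g) (hf : ∃ s : X → Ve, K.IsSimplicialMap E s ∧ p ∘ s = f) :
    ∃ s : X → Ve, K.IsSimplicialMap E s ∧ p ∘ s = g := by
  induction hfg with
  | refl => exact hf
  | @tail b c _ hbc ih =>
    obtain ⟨hb, hc, hcont⟩ := hbc
    obtain ⟨s, hs, hps⟩ := ih
    obtain ⟨t, -, ht, -, hpt⟩ := hfib X K 1 ![b, c]
      (Fin.forall_fin_two.2 ⟨hb, hc⟩) (Fin.forall_fin_one.2 hcont) s hs hps
    exact ⟨t 1, ht 1, hpt 1⟩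

/-- if `p : E → B` is a simplicial fibration then
`hsecat_m(p) = secat_m(p)`. -/
theorem hsecatm_eq_secatm_of_fibration {Ve Vb : Type} (E : SComplex Ve) (B : SComplex Vb)
    (p : Ve → Vb) (hp : E.IsSimplicialMap B p) (hfib : IsFibration E B p)
    (m : ℕ) (hm : 1 ≤ m) :
    hsecatm m E B p = secatm m E B p := by
  unfold hsecatm secatm
  congr! 12 with n k Ls j P PC
  refine forall₃_congr fun _ η _ => ?_
  constructor
  · rintro ⟨s, hs, hsη⟩
    exact hfib.exists_lift_of_sameClass hsη ⟨s, hs, rfl⟩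
  · rintro ⟨s, hs, rfl⟩
    exact ⟨s, hs, Relation.ReflTransGen.refl⟩
end
end

section
/- Let φ : K → L be a simplicial map that factors as φ = p ∘ β, where β : K → M is a strong equivalence and p : M → L is a simplicial fibration, and fix an integer m ≥ 1. Then hsecat_m(φ) = hsecat_m(p). -/
noncomputable section
open scoped Classical

open SComplex

namespace SComplex

variable {A B C D : Type} {P : SComplex A} {Q : SComplex B} {R : SComplex C} {S : SComplex D}

theorem IsSimplicialMap.comp_s19 {g : B → C} {f : A → B} (hg : Q.IsSimplicialMap R g)
    (hf : P.IsSimplicialMap Q f) : P.IsSimplicialMap R (g ∘ f) := fun σ hσ => by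
  rw [← Finset.image_image]
  exact hg _ (hf σ hσ)

/-- Contiguity classes are preserved by pre- and postcomposition with simplicial maps. -/
theorem SameClass.whisker {f g : B → C} {u : C → D} {s : A → B} (h : Q.SameClass R f g)
    (hu : R.IsSimplicialMap S u) (hs : P.IsSimplicialMap Q s) :
    P.SameClass S (u ∘ f ∘ s) (u ∘ g ∘ s) := by
  refine Relation.ReflTransGen.lift (fun a : B → C => u ∘ a ∘ s) ?_ _ _ h
  rintro a b ⟨ha, hb, hab⟩
  refine ⟨hu.comp_s19 (ha.comp_s19 hs), hu.comp_s19 (hb.comp_s19 hs), fun σ hσ => ?_⟩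
  have key := hu _ (hab _ (hs σ hσ))
  simpa only [Finset.image_union, Finset.image_image] using key

/-- If simplicial maps into the domain of `f` can be replaced, up to contiguity class after
mapping to the base, by simplicial maps into the domain of `g`, then the genus of `g` is at most
that of `f`. -/
theorem hsecatm_le_hsecatm (m : ℕ) {f : A → C} {g : B → C}
    (h : ∀ (X : Type) (N : SComplex X) (s : X → A), N.IsSimplicialMap P s →
      ∃ t : X → B, N.IsSimplicialMap Q t ∧ N.SameClass R (g ∘ t) (f ∘ s)) :
    hsecatm m Q R g ≤ hsecatm m P R f := by
  apply sInf_le_sInf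
  rintro n ⟨k, hn, Ls, hLs, hs⟩
  refine ⟨k, hn, Ls, hLs, fun j X N hN η hη => ?_⟩
  obtain ⟨s, hsimp, hclass⟩ := hs j X N hN η hη
  obtain ⟨t, ht, htclass⟩ := h X N s hsimp
  exact ⟨t, ht, htclass.trans hclass⟩

end SComplex

/-- if `φ = p ∘ β` with `β` a strong equivalence and `p` a simplicial
fibration, then `hsecat_m(φ) = hsecat_m(p)`. -/
theorem hsecatm_eq_of_factorization {V U W : Type} (K : SComplex V) (M : SComplex U)
    (L : SComplex W) (φ : V → W) (β : V → U) (p : U → W)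
    (hφ : K.IsSimplicialMap L φ)
    (hβ : K.IsStrongEquivalence M β)
    (hp : M.IsSimplicialMap L p) (hfib : IsFibration M L p)
    (hfac : φ = p ∘ β) (m : ℕ) (hm : 1 ≤ m) :
    hsecatm m K L φ = hsecatm m M L p := by
  subst hfac
  obtain ⟨hβ, δ, hδ, -, hβδ⟩ := hβ
  apply le_antisymm
  · exact hsecatm_le_hsecatm m fun X N s hs => ⟨δ ∘ s, hδ.comp_s19 hs, hβδ.whisker hp hs⟩
  · exact hsecatm_le_hsecatm m fun X N s hs =>
      ⟨β ∘ s, hβ.comp_s19 hs, Relation.ReflTransGen.refl⟩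
end
end
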